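/- There is no countable product of ℂ in the category of unital C*-algebras and positive bounded linear maps: there do not exist a unital C*-algebra P and positive bounded linear maps π_n : P → ℂ (n ∈ ℕ) such that for every unital C*-algebra C and every family of positive bounded linear maps f_n : C → ℂ (n ∈ ℕ) there is a unique positive bounded linear map f : C → P with π_n ∘ f = f_n for all n ∈ ℕ. -/

import Mathlib

/-!
Statement 11: There is no countable product of `ℂ` in the category of unital
C*-algebras and positive bounded linear maps: there do not exist a unital C*-algebra
`P` and positive bounded linear maps `π n : P → ℂ` (`n ∈ ℕ`) such that for every unital
C*-algebra `C` and every family of positive bounded linear maps `f n : C → ℂ` there is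
a unique positive bounded linear map `f : C → P` with `π n ∘ f = f n` for all `n`.
-/

open scoped ComplexOrder

universe u

theorem no_countable_product_of_C_in_positive_bounded_maps :
    ¬ ∃ (P : Type u) (_ : CStarAlgebra P) (_ : PartialOrder P) (_ : StarOrderedRing P)
        (π : ℕ → (P →L[ℂ] ℂ)),
        (∀ n (x : P), 0 ≤ x → 0 ≤ π n x) ∧
        ∀ (C : Type u) [CStarAlgebra C] [PartialOrder C] [StarOrderedRing C]
          (f : ℕ → (C →L[ℂ] ℂ)), (∀ n (c : C), 0 ≤ c → 0 ≤ f n c) →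
          ∃! F : C →L[ℂ] P,
            (∀ c : C, 0 ≤ c → 0 ≤ F c) ∧ ∀ n (c : C), π n (F c) = f n c := by
  rintro ⟨P, _, _, _, π, hπ, h⟩
  -- the values to be realised
  let t : ℕ → ℝ := fun n => n * ((π n 1).re + 1)
  have h1 : ∀ n, 0 ≤ (π n 1).re := fun n => (Complex.le_def.1 (hπ n 1 zero_le_one)).1
  have ht : ∀ n, 0 ≤ t n := fun n => mul_nonneg (Nat.cast_nonneg n) (by linarith [h1 n])
  obtain ⟨F, ⟨hF, hFt⟩, -⟩ := h C(PUnit.{u+1}, ℂ)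
    (fun n => (t n : ℂ) • ContinuousMap.evalCLM ℂ PUnit.unit) (by
      intro n c hc
      have hc' : 0 ≤ c PUnit.unit := hc PUnit.unit
      have htn : (0 : ℂ) ≤ (t n : ℂ) := by exact_mod_cast ht n
      simpa using mul_nonneg htn hc')
  have hone : (0 : C(PUnit.{u+1}, ℂ)) ≤ 1 := fun _ => zero_le_one
  have hx : 0 ≤ F 1 := hF 1 hone
  have hle : F 1 ≤ algebraMap ℝ P ‖F 1‖ :=
    IsSelfAdjoint.le_algebraMap_norm_self (IsSelfAdjoint.of_nonneg hx)
  obtain ⟨n, hn⟩ := exists_nat_gt ‖F 1‖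
  have h2 := hπ n _ (sub_nonneg.2 hle)
  have h3 : algebraMap ℝ P ‖F 1‖ = (‖F 1‖ : ℂ) • (1 : P) := by
    rw [Algebra.algebraMap_eq_smul_one, Complex.coe_smul]
  rw [map_sub, hFt, h3, map_smul] at h2
  have h4 := (Complex.le_def.1 h2).1
  have h5 : t n ≤ ‖F 1‖ * (π n 1).re := by simpa using h4
  have h6 : ‖F 1‖ * (π n 1).re ≤ n * (π n 1).re :=
    mul_le_mul_of_nonneg_right hn.le (h1 n)
  have h7 : (n : ℝ) * ((π n 1).re + 1) ≤ n * (π n 1).re := h5.trans h6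
  have h8 := norm_nonneg (F 1)
  linarith
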